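/- Let α₁ < α₂ < β₂ be real numbers and set A := ((β₂−α₂)/4)², B := (α₂+β₂)/2, b₀ := ½(α₁ + B) − ½·√((α₂−α₁)(β₂−α₁)). Let 𝒜₂ be the unique bounded self-adjoint operator on ℓ²(ℕ) acting by (𝒜₂u)₀ = b₀·u₀ + √A·u₁ and (𝒜₂u)_n = √A·u_{n−1} + B·u_n + √A·u_{n+1} for n ≥ 1. Then spectrum(𝒜₂) = {α₁} ∪ [α₂, β₂] (as a subset of ℂ), and α₁ is an eigenvalue of 𝒜₂. -/

import Mathlib

noncomputable section

/-- The Hilbert space `ℓ²(ℕ)`. -/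
abbrev Hseq : Type := lp (fun _ : ℕ => ℂ) 2

open scoped InnerProductSpace
open Filter Topology

lemma memℓp_shift (u : Hseq) : Memℓp (fun n => u (n + 1)) 2 := by
  have h := lp.memℓp u
  rw [memℓp_gen_iff (by norm_num)] at h ⊢
  exact h.comp_injective (add_left_injective 1)

/-- The backward shift on `ℓ²(ℕ)`. -/
def backShift : Hseq →L[ℂ] Hseq :=
  LinearMap.mkContinuous
    { toFun := fun u => (⟨fun n => u (n + 1), memℓp_shift u⟩ : Hseq)
      map_add' := fun _ _ => by ext n; rfl
      map_smul' := fun _ _ => by ext n; rfl } 1 (by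
    intro u
    rw [one_mul]
    refine lp.norm_le_of_tsum_le (by norm_num) (norm_nonneg _) ?_
    rw [lp.norm_rpow_eq_tsum (by norm_num)]
    have h := lp.memℓp u
    rw [memℓp_gen_iff (by norm_num)] at h
    exact tsum_comp_le_tsum_of_inj h (fun _ => by positivity) (add_left_injective 1))

@[simp] lemma backShift_apply (u : Hseq) (n : ℕ) : backShift u n = u (n + 1) := rfl

lemma norm_backShift_le : ‖backShift‖ ≤ 1 :=
  LinearMap.mkContinuous_norm_le _ zero_le_one _

/-- The forward shift on `ℓ²(ℕ)`. -/
def fwdShift : Hseq →L[ℂ] Hseq := ContinuousLinearMap.adjoint backShift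

lemma norm_fwdShift_le : ‖fwdShift‖ ≤ 1 := by
  rw [fwdShift, LinearIsometryEquiv.norm_map]
  exact norm_backShift_le

lemma fwdShift_inner (u : Hseq) (n : ℕ) :
    fwdShift u n = ⟪backShift (lp.single 2 n (1 : ℂ)), u⟫_ℂ := by
  rw [← ContinuousLinearMap.adjoint_inner_right, lp.inner_single_left]
  simp [fwdShift]

@[simp] lemma fwdShift_apply_zero (u : Hseq) : fwdShift u 0 = 0 := by
  have h : backShift (lp.single 2 0 (1 : ℂ)) = 0 := by
    ext n
    simp [lp.single_apply]
  rw [fwdShift_inner, h, inner_zero_left]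

@[simp] lemma fwdShift_apply_succ (u : Hseq) (n : ℕ) : fwdShift u (n + 1) = u n := by
  have h : backShift (lp.single 2 (n + 1) (1 : ℂ)) = lp.single 2 n (1 : ℂ) := by
    ext k
    simp [lp.single_apply, Pi.single_apply]
  rw [fwdShift_inner, h, lp.inner_single_left]
  simp

lemma backShift_mul_fwdShift : backShift * fwdShift = 1 := by
  ext u n
  simp

/-- Factorization of a rank-one perturbation of `L + R` when `L * R = 1`. -/
lemma factor_of_mul_eq_one {A : Type*} [Ring A] [Algebra ℂ A] {L R : A} (h : L * R = 1)
    (z c : ℂ) :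
    (1 - z • L) * ((1 - c • (1 - R * L)) * (1 - z • R)) =
      (1 + z ^ 2) • (1 : A) - z • (L + R) - c • (1 - R * L) := by
  have h1 : L * (1 - R * L) = 0 := by rw [mul_sub, ← mul_assoc, h]; simp
  have h2 : (1 - R * L) * R = 0 := by rw [sub_mul, mul_assoc, h]; simp
  have h3 : (1 - c • (1 - R * L)) * (1 - z • R) = 1 - z • R - c • (1 - R * L) := by
    rw [sub_mul, one_mul, smul_mul_assoc, mul_sub, mul_smul_comm, h2]; simp
  rw [h3, sub_mul, one_mul, smul_mul_assoc, mul_sub, mul_sub, mul_smul_comm, mul_smul_comm, h1, h]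
  simp only [mul_one, smul_zero, sub_zero]
  module

lemma isUnit_one_sub_smul_compl {A : Type*} [Ring A] [Algebra ℂ A] {L R : A} (h : L * R = 1)
    {c : ℂ} (hc : c ≠ 1) : IsUnit (1 - c • (1 - R * L)) := by
  have hP : (1 - R * L) * (1 - R * L) = 1 - R * L := by
    have h1 : R * L * (R * L) = R * L := by
      rw [mul_assoc, ← mul_assoc L, h, one_mul]
    rw [sub_mul, mul_sub, mul_sub, h1]; simp
  generalize 1 - R * L = P at hP
  have key : ∀ x y : ℂ, x + y = x * y → (1 - x • P) * (1 - y • P) = 1 := by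
    intro x y hxy
    rw [sub_mul, mul_sub, mul_sub, smul_mul_smul_comm, hP, ← hxy, one_mul, mul_one, one_mul, add_smul]
    abel
  have hxy : c + c / (c - 1) = c * (c / (c - 1)) := by
    have : c - 1 ≠ 0 := sub_ne_zero.2 hc
    field_simp
    ring
  exact isUnit_iff_exists.2 ⟨_, key _ _ hxy, key _ _ (by rw [add_comm, hxy, mul_comm])⟩

lemma isUnit_one_sub_smul {S : Hseq →L[ℂ] Hseq} (hS : ‖S‖ ≤ 1) {z : ℂ} (hz : ‖z‖ < 1) :
    IsUnit (1 - z • S) := by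
  apply isUnit_one_sub_of_norm_lt_one
  rw [norm_smul]
  nlinarith [norm_nonneg z, norm_nonneg S]

lemma memℓp_inv_succ_mul_pow {w : ℂ} (hw : ‖w‖ = 1) :
    Memℓp (fun n : ℕ => w ^ n * (((1 / ((n : ℝ) + 1) : ℝ)) : ℂ)) 2 := by
  rw [memℓp_gen_iff (by norm_num)]
  have h : Summable fun n : ℕ => 1 / ((n + 1 : ℕ) : ℝ) ^ 2 :=
    (summable_nat_add_iff 1).2 (Real.summable_one_div_nat_pow.2 one_lt_two)
  refine h.congr fun n => ?_
  rw [norm_mul, norm_pow, hw, one_pow, one_mul, Complex.norm_real, Real.norm_eq_abs,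
    abs_of_nonneg (by positivity)]
  norm_num

lemma tendsto_norm_coord (u : Hseq) : Tendsto (fun n => ‖u n‖) atTop (𝓝 0) := by
  have h := lp.memℓp u
  rw [memℓp_gen_iff (by norm_num)] at h
  have h2 := h.tendsto_atTop_zero
  have h3 := h2.sqrt
  simpa using h3

lemma not_surjective_one_sub_smul_backShift {z : ℂ} (hz : ‖z‖ = 1) :
    ¬ Function.Surjective (1 - z • backShift : Hseq →L[ℂ] Hseq) := by
  intro hs
  have hz0 : z ≠ 0 := by rintro rfl; simp at hz
  obtain ⟨u, hu⟩ := hs ⟨_, memℓp_inv_succ_mul_pow (w := z⁻¹) (by simp [hz])⟩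
  have hstep (n : ℕ) : z ^ (n + 1) * u (n + 1) = z ^ n * u n - ((1 / ((n : ℝ) + 1) : ℝ) : ℂ) := by
    have h : u n - z * u (n + 1) = z⁻¹ ^ n * ((1 / ((n : ℝ) + 1) : ℝ) : ℂ) :=
      congrArg (fun v : Hseq => v n) hu
    have h2 : z ^ n * z⁻¹ ^ n = 1 := by rw [← mul_pow, mul_inv_cancel₀ hz0, one_pow]
    linear_combination (-z ^ n) * h - ((1 / ((n : ℝ) + 1) : ℝ) : ℂ) * h2
  have hsum (n : ℕ) : z ^ n * u n = u 0 - ((∑ k ∈ Finset.range n, 1 / ((k : ℝ) + 1) : ℝ) : ℂ) := by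
    induction n with
    | zero => simp
    | succ n ih => rw [hstep, ih, Finset.sum_range_succ, Complex.ofReal_add]; ring
  have hle (n : ℕ) : ∑ k ∈ Finset.range n, 1 / ((k : ℝ) + 1) ≤ ‖u 0‖ + ‖u n‖ := by
    have h : ((∑ k ∈ Finset.range n, 1 / ((k : ℝ) + 1) : ℝ) : ℂ) = u 0 - z ^ n * u n := by
      rw [hsum]; ring
    calc _ ≤ ‖((∑ k ∈ Finset.range n, 1 / ((k : ℝ) + 1) : ℝ) : ℂ)‖ := by
          rw [Complex.norm_real]; exact le_abs_self _
      _ ≤ ‖u 0‖ + ‖z ^ n * u n‖ := by rw [h]; exact norm_sub_le _ _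
      _ = _ := by rw [norm_mul, norm_pow, hz, one_pow, one_mul]
  have hlim := (tendsto_norm_coord u).const_add ‖u 0‖
  exact not_tendsto_nhds_of_tendsto_atTop
    (tendsto_atTop_mono hle Real.tendsto_sum_range_one_div_nat_succ_atTop) _ hlim

lemma exists_norm_le_one_add_inv_eq (w : ℂ) : ∃ z : ℂ, z ≠ 0 ∧ ‖z‖ ≤ 1 ∧ z + z⁻¹ = w := by
  obtain ⟨s, hs⟩ := IsAlgClosed.exists_pow_nat_eq (w ^ 2 - 4) (n := 2) two_pos
  have hmul : (w + s) / 2 * ((w - s) / 2) = 1 := by linear_combination (-1 / 4) * hs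
  have hx : (w + s) / 2 ≠ 0 := left_ne_zero_of_mul_eq_one hmul
  have hy : (w - s) / 2 ≠ 0 := right_ne_zero_of_mul_eq_one hmul
  rcases le_total ‖(w + s) / 2‖ 1 with h | h
  · exact ⟨_, hx, h, by rw [inv_eq_of_mul_eq_one_right hmul]; ring⟩
  · refine ⟨_, hy, ?_, by rw [inv_eq_of_mul_eq_one_left hmul]; ring⟩
    have := congrArg norm hmul
    rw [norm_mul, norm_one] at this
    nlinarith [norm_nonneg ((w - s) / 2)]

lemma add_inv_eq_of_norm_eq_one {z : ℂ} (hz : ‖z‖ = 1) : z + z⁻¹ = ((2 * z.re : ℝ) : ℂ) := by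
  rw [Complex.inv_eq_conj hz, Complex.add_conj]

lemma exists_norm_eq_one_re_eq {x : ℝ} (hx : |x| ≤ 1) : ∃ z : ℂ, ‖z‖ = 1 ∧ z.re = x :=
  ⟨Complex.exp (Real.arccos x * Complex.I), Complex.norm_exp_ofReal_mul_I _, by
    rw [Complex.exp_ofReal_mul_I_re, Real.cos_arccos (abs_le.1 hx).1 (abs_le.1 hx).2]⟩

lemma memℓp_pow {q : ℝ} (hq : |q| < 1) : Memℓp (fun n : ℕ => (q : ℂ) ^ n) 2 := by
  rw [memℓp_gen_iff (by norm_num)]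
  have h : Summable fun n : ℕ => (q ^ 2) ^ n :=
    summable_geometric_of_lt_one (sq_nonneg q) ((sq_lt_one_iff_abs_lt_one q).2 hq)
  refine h.congr fun n => ?_
  rw [norm_pow, Complex.norm_real, Real.norm_eq_abs, ← sq_abs]
  simp only [ENNReal.toReal_ofNat, Real.rpow_ofNat]
  ring

lemma spectrum_jacobi {a B q : ℝ} (ha : 0 < a) (hq0 : q ≠ 0) (hq : |q| < 1)
    (T : Hseq →L[ℂ] Hseq)
    (hT0 : ∀ u : Hseq, (T u) 0 = ((B + a / q : ℝ) : ℂ) * u 0 + (a : ℂ) * u 1)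
    (hT : ∀ (u : Hseq) (n : ℕ),
      (T u) (n + 1) = (a : ℂ) * u n + (B : ℂ) * u (n + 1) + (a : ℂ) * u (n + 2)) :
    spectrum ℂ T = {((B + a * (q + q⁻¹) : ℝ) : ℂ)} ∪
      Complex.ofReal '' Set.Icc (B - 2 * a) (B + 2 * a) ∧
    ∃ u : Hseq, u ≠ 0 ∧ T u = ((B + a * (q + q⁻¹) : ℝ) : ℂ) • u := by
  have haC : (a : ℂ) ≠ 0 := by exact_mod_cast ha.ne'
  have hqC : (q : ℂ) ≠ 0 := by exact_mod_cast hq0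
  have hop : T = (a : ℂ) • (backShift + fwdShift) + (B : ℂ) • (1 : Hseq →L[ℂ] Hseq) +
      ((a : ℂ) / q) • (1 - fwdShift * backShift) := by
    ext u n
    change T u n = a * (u (n + 1) + fwdShift u n) + B * u n +
      a / q * (u n - fwdShift (backShift u) n)
    cases n with
    | zero =>
      rw [hT0, fwdShift_apply_zero, fwdShift_apply_zero]
      push_cast
      ring
    | succ n =>
      rw [hT, fwdShift_apply_succ, fwdShift_apply_succ, backShift_apply]
      ring
  have hfac (z : ℂ) (hz : z ≠ 0) :
      algebraMap ℂ (Hseq →L[ℂ] Hseq) (B + a * (z + z⁻¹)) - T =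
      ((a : ℂ) / z) • ((1 - z • backShift) *
        ((1 - (z / q) • (1 - fwdShift * backShift)) * (1 - z • fwdShift))) := by
    rw [factor_of_mul_eq_one backShift_mul_fwdShift, hop, Algebra.algebraMap_eq_smul_one]
    match_scalars <;> field_simp <;> ring
  have heig : ∃ u : Hseq, u ≠ 0 ∧ T u = ((B + a * (q + q⁻¹) : ℝ) : ℂ) • u := by
    refine ⟨⟨_, memℓp_pow hq⟩, fun h => ?_, ?_⟩
    · simpa using congrArg (fun v : Hseq => v 0) h
    · ext n
      cases n with
      | zero =>
        rw [hT0]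
        simp
        field_simp
        ring
      | succ n =>
        rw [hT]
        simp
        field_simp
        ring
  refine ⟨Set.Subset.antisymm ?_ ?_, heig⟩
  · intro μ hμ
    obtain ⟨z, hz0, hz1, hz⟩ := exists_norm_le_one_add_inv_eq ((μ - B) / a)
    have hμz : μ = B + a * (z + z⁻¹) := by rw [hz]; field_simp; ring
    rcases hz1.lt_or_eq with hlt | heq
    · left
      by_cases hzq : z = q
      · rw [hμz, hzq]; simp
      · refine absurd ?_ (spectrum.mem_iff.1 hμ)
        rw [hμz, hfac z hz0]
        have hzq' : z / q ≠ 1 := fun h => hzq ((div_eq_one_iff_eq hqC).1 h)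
        exact ((isUnit_one_sub_smul norm_backShift_le hlt).mul
          ((isUnit_one_sub_smul_compl backShift_mul_fwdShift hzq').mul
            (isUnit_one_sub_smul norm_fwdShift_le hlt))).smul
              (Units.mk0 _ (div_ne_zero haC hz0))
    · right
      rw [add_inv_eq_of_norm_eq_one heq] at hμz
      have := abs_le.1 (heq ▸ Complex.abs_re_le_norm z)
      refine ⟨B + a * (2 * z.re), ⟨?_, ?_⟩, by rw [hμz]; push_cast; ring⟩ <;> nlinarith
  · rintro μ (rfl | ⟨x, hx, rfl⟩)
    · obtain ⟨u, hu0, hu⟩ := heig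
      rw [spectrum.mem_iff]
      intro hunit
      obtain ⟨Y, -, hY⟩ := isUnit_iff_exists.1 hunit
      apply hu0
      have h := congrArg (fun S : Hseq →L[ℂ] Hseq => S u) hY
      simpa [Algebra.algebraMap_eq_smul_one, hu] using h.symm
    · obtain ⟨z, hz, hre⟩ := exists_norm_eq_one_re_eq (x := (x - B) / (2 * a)) (by
        rw [abs_le, le_div_iff₀ (by positivity), div_le_iff₀ (by positivity)]
        constructor <;> linarith [hx.1, hx.2])
      have hz0 : z ≠ 0 := by rintro rfl; simp at hz
      have hxz : (x : ℂ) = B + a * (z + z⁻¹) := by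
        rw [add_inv_eq_of_norm_eq_one hz, hre]
        push_cast
        field_simp
        ring
      rw [spectrum.mem_iff, hxz, hfac z hz0]
      intro hunit
      obtain ⟨Y, hY, -⟩ := isUnit_iff_exists.1 hunit
      refine not_surjective_one_sub_smul_backShift hz fun f => ?_
      rw [← mul_smul_comm, mul_assoc] at hY
      exact ⟨_, congrArg (fun S : Hseq →L[ℂ] Hseq => S f) hY⟩

/-- The one-sided Jacobi matrix `𝒜₂` with constant off-diagonal `√A`, constant diagonal
`B` except for the modified first entry `b₀`, has spectrum `{α₁} ∪ [α₂,β₂]` and `α₁` is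
an eigenvalue. -/
theorem stmt18 (α₁ α₂ β₂ : ℝ) (h₁ : α₁ < α₂) (h₂ : α₂ < β₂)
    (T : Hseq →L[ℂ] Hseq) (hsa : IsSelfAdjoint T)
    (hact : ∀ (u : Hseq) (n : ℕ),
      (T u) n =
        if n = 0 then
          (((α₁ + (α₂ + β₂) / 2) / 2 - Real.sqrt ((α₂ - α₁) * (β₂ - α₁)) / 2 : ℝ) : ℂ) * u 0
            + ((Real.sqrt (((β₂ - α₂) / 4) ^ 2) : ℝ) : ℂ) * u 1
        else
          ((Real.sqrt (((β₂ - α₂) / 4) ^ 2) : ℝ) : ℂ) * u (n - 1)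
            + (((α₂ + β₂) / 2 : ℝ) : ℂ) * u n
            + ((Real.sqrt (((β₂ - α₂) / 4) ^ 2) : ℝ) : ℂ) * u (n + 1)) :
    spectrum ℂ T = {(α₁ : ℂ)} ∪ Complex.ofReal '' Set.Icc α₂ β₂ ∧
    ∃ u : Hseq, u ≠ 0 ∧ T u = (α₁ : ℂ) • u := by
  have ha : 0 < (β₂ - α₂) / 4 := by linarith
  rw [Real.sqrt_sq ha.le] at hact
  set a := (β₂ - α₂) / 4 with ha_def
  set B := (α₂ + β₂) / 2 with hB_def
  set s := Real.sqrt ((α₂ - α₁) * (β₂ - α₁)) with hs_def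
  have hs0 : 0 < s := Real.sqrt_pos.2 (mul_pos (by linarith) (by linarith))
  have hs2 : s ^ 2 = (B - α₁) ^ 2 - 4 * a ^ 2 := by
    rw [hs_def, Real.sq_sqrt (mul_nonneg (by linarith) (by linarith)), ha_def, hB_def]
    ring
  have hBa : 2 * a < B - α₁ := by rw [ha_def, hB_def]; linarith
  have hsB : s < B - α₁ := by nlinarith
  have hlt : B - α₁ - s < 2 * a := by nlinarith
  set q := (α₁ - B + s) / (2 * a) with hq_def
  have hqneg : q < 0 := div_neg_of_neg_of_pos (by linarith) (by positivity)
  have hq1 : |q| < 1 := by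
    rw [abs_lt]
    refine ⟨?_, by linarith⟩
    rw [hq_def, lt_div_iff₀ (by positivity)]
    linarith
  have haq : a * q = (α₁ - B + s) / 2 := by rw [hq_def]; field_simp
  have hdiv : a / q = (α₁ - B - s) / 2 := by
    rw [div_eq_iff hqneg.ne, hq_def]
    field_simp
    linear_combination hs2
  have hα : B + a * (q + q⁻¹) = α₁ := by
    rw [mul_add, ← div_eq_mul_inv, hdiv, haq]; ring
  have hb : B + a / q = (α₁ + B) / 2 - s / 2 := by rw [hdiv]; ring
  have key := spectrum_jacobi (B := B) ha hqneg.ne hq1 T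
    (fun u => by rw [hact, if_pos rfl, hb])
    (fun u n => by rw [hact, if_neg (Nat.succ_ne_zero n)]; rfl)
  have hlo : B - 2 * a = α₂ := by rw [ha_def, hB_def]; ring
  have hhi : B + 2 * a = β₂ := by rw [ha_def, hB_def]; ring
  rwa [hα, hlo, hhi] at key
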